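/- arXiv:1906.00573 — 2 statements merged into one kernel-verified Lean document; each statement's English description precedes it below -/
import Mathlib

section
/- Let $Y$ be a random vector in $\mathbb{R}^n$ distributed according to a (nondegenerate) Gaussian measure $P$ with mean vector $\mu$ and covariance matrix $\Sigma$. Let $A$ be a real $m \times n$ matrix, $b \in \mathbb{R}^m$, and $\eta \in \mathbb{R}^n$ with $\eta^\top \Sigma \eta > 0$. Define $c = \Sigma\eta / (\eta^\top \Sigma \eta)$ and, for each $y \in \mathbb{R}^n$, $z(y) = y - c\,(\eta^\top y)$. Assume the index sets $J_- = \{j : (Ac)_j < 0\}$ and $J_+ = \{j : (Ac)_j > 0\}$ are both nonempty, and define $V^-(y) = \max_{j \in J_-} (b_j - (A z(y))_j)/(Ac)_j$ and $V^+(y) = \min_{j \in J_+} (b_j - (A z(y))_j)/(Ac)_j$. Assume the event $E = \{y : A y \le b\}$ (componentwise) has positive probability. Then the pushforward under the map $y \mapsto F\big(\eta^\top y;\, V^-(y),\, V^+(y),\, \eta^\top\mu,\, \eta^\top\Sigma\eta\big)$ of the conditional measure $P(\cdot \mid E)$ is the uniform distribution on $[0,1]$. -/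
open MeasureTheory ProbabilityTheory Matrix

/-- The standard Gaussian measure on `ℝⁿ`: the `n`-fold product of standard normals. -/
noncomputable def stdGaussianPi (n : ℕ) : Measure (Fin n → ℝ) :=
  Measure.pi (fun _ => gaussianReal 0 1)

/-- `P` is a Gaussian measure on `ℝⁿ` with mean vector `μ` and covariance matrix `S`:
the pushforward of the standard Gaussian under an affine map `z ↦ μ + A z` with `A Aᵀ = S`. -/
def IsGaussianMeasure (n : ℕ) (P : Measure (Fin n → ℝ)) (μ : Fin n → ℝ)
    (S : Matrix (Fin n) (Fin n) ℝ) : Prop :=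
  ∃ A : Matrix (Fin n) (Fin n) ℝ, A * Aᵀ = S ∧
    P = (stdGaussianPi n).map (fun z => μ + A.mulVec z)

/-- The standard normal cumulative distribution function `Φ`. -/
noncomputable def stdNormCDF (x : ℝ) : ℝ := ProbabilityTheory.cdf (gaussianReal 0 1) x

/-- The CDF of a normal distribution with mean `m` and variance `v`, truncated to `[a, b]`. -/
noncomputable def truncNormCDF (x a b m v : ℝ) : ℝ :=
  (stdNormCDF ((x - m) / Real.sqrt v) - stdNormCDF ((a - m) / Real.sqrt v)) /
    (stdNormCDF ((b - m) / Real.sqrt v) - stdNormCDF ((a - m) / Real.sqrt v))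


lemma pl_hasGaussianLaw_id (n : ℕ) : HasGaussianLaw (fun x : Fin n → ℝ => x) (stdGaussianPi n) := by
  have h : iIndepFun (fun (i : Fin n) (x : Fin n → ℝ) => x i) (stdGaussianPi n) := by
    unfold stdGaussianPi
    exact iIndepFun_pi (X := fun _ x => x) (fun i => aemeasurable_id)
  refine h.hasGaussianLaw (fun i => ?_)
  have h2 : HasLaw (fun x : Fin n → ℝ => x i) (gaussianReal 0 1) (stdGaussianPi n) :=
    ⟨(measurable_pi_apply i).aemeasurable, (measurePreserving_eval (fun _ : Fin n => gaussianReal 0 1) i).map_eq⟩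
  exact h2.hasGaussianLaw

instance pl_isProb (n : ℕ) : IsProbabilityMeasure (stdGaussianPi n) := by
  unfold stdGaussianPi; infer_instance

lemma pl_law_dot (n : ℕ) (u : Fin n → ℝ) :
    HasGaussianLaw (fun x : Fin n → ℝ => u ⬝ᵥ x) (stdGaussianPi n) := by
  have := (pl_hasGaussianLaw_id n).map_fun
    (LinearMap.toContinuousLinearMap (dotProductBilin ℝ ℝ u))
  exact this

lemma pl_eval_law (n : ℕ) (i : Fin n) :
    HasLaw (fun x : Fin n → ℝ => x i) (gaussianReal 0 1) (stdGaussianPi n) :=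
  ⟨(measurable_pi_apply i).aemeasurable, (measurePreserving_eval (fun _ : Fin n => gaussianReal 0 1) i).map_eq⟩

lemma pl_cov_eval (n : ℕ) (i j : Fin n) :
    cov[fun x => x i, fun x => x j; stdGaussianPi n] = if i = j then 1 else 0 := by
  split_ifs with hij
  · subst hij
    rw [covariance_self (measurable_pi_apply i).aemeasurable, (pl_eval_law n i).variance_eq]
    simp
  · have h : iIndepFun (fun (i : Fin n) (x : Fin n → ℝ) => x i) (stdGaussianPi n) := by
      unfold stdGaussianPi
      exact iIndepFun_pi (X := fun _ x => x) (fun i => aemeasurable_id)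
    exact (h.indepFun hij).covariance_eq_zero
      ((pl_eval_law n i).hasGaussianLaw.memLp_two) ((pl_eval_law n j).hasGaussianLaw.memLp_two)

lemma pl_cov_dot (n : ℕ) (u w : Fin n → ℝ) :
    cov[fun x => u ⬝ᵥ x, fun x => w ⬝ᵥ x; stdGaussianPi n] = u ⬝ᵥ w := by
  simp only [dotProduct]
  rw [covariance_fun_sum_fun_sum]
  · simp_rw [covariance_const_mul_left, covariance_const_mul_right, pl_cov_eval]
    simp
  · exact fun i => ((pl_eval_law n i).hasGaussianLaw.memLp_two).const_mul _
  · exact fun i => ((pl_eval_law n i).hasGaussianLaw.memLp_two).const_mul _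

lemma pl_mean_dot (n : ℕ) (u : Fin n → ℝ) :
    ∫ x, u ⬝ᵥ x ∂(stdGaussianPi n) = 0 := by
  simp only [dotProduct]
  rw [integral_finsetSum]
  · refine Finset.sum_eq_zero fun i _ => ?_
    rw [integral_const_mul, (pl_eval_law n i).integral_eq]
    simp
  · exact fun i _ => ((pl_eval_law n i).hasGaussianLaw.integrable).const_mul _

lemma pl_map_dot (n : ℕ) (u : Fin n → ℝ) (hu : u ⬝ᵥ u = 1) :
    (stdGaussianPi n).map (fun x => u ⬝ᵥ x) = gaussianReal 0 1 := by
  rw [(pl_law_dot n u).map_eq_gaussianReal, pl_mean_dot,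
    ← covariance_self (pl_law_dot n u).aemeasurable, pl_cov_dot, hu]
  simp

lemma pl_indep (n : ℕ) (u : Fin n → ℝ) (M : Matrix (Fin n) (Fin n) ℝ) (h : M.mulVec u = 0) :
    IndepFun (fun x => u ⬝ᵥ x) (fun x => M.mulVec x) (stdGaussianPi n) := by
  have h1 : IndepFun (fun (x : Fin n → ℝ) (_ : Unit) => u ⬝ᵥ x) (fun x j => M.mulVec x j)
      (stdGaussianPi n) := by
    refine HasGaussianLaw.indepFun_of_covariance_eval (X := fun _ x => u ⬝ᵥ x)
      (Y := fun j x => M.mulVec x j) ?_ ?_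
    · exact (pl_hasGaussianLaw_id n).map_fun
        ((LinearMap.toContinuousLinearMap
          (LinearMap.pi (fun _ : Unit => dotProductBilin ℝ ℝ u))).prod
          (LinearMap.toContinuousLinearMap (Matrix.mulVecLin M)))
    · intro _ j
      have := pl_cov_dot n u (M j)
      rw [dotProduct_comm] at this
      exact this.trans (congrFun h j)
  have hm : Measurable (fun f : Unit → ℝ => f ()) := measurable_pi_apply ()
  exact h1.comp hm measurable_id

lemma pl_map_prod (n : ℕ) (u : Fin n → ℝ) (M : Matrix (Fin n) (Fin n) ℝ) (h : M.mulVec u = 0)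
    (hu : u ⬝ᵥ u = 1) :
    (stdGaussianPi n).map (fun x => (u ⬝ᵥ x, M.mulVec x)) =
      (gaussianReal 0 1).prod ((stdGaussianPi n).map (fun x => M.mulVec x)) := by
  rw [← pl_map_dot n u hu]
  refine (indepFun_iff_map_prod_eq_prod_map_map (pl_law_dot n u).aemeasurable ?_).1
    (pl_indep n u M h)
  have : Continuous (fun x : Fin n → ℝ => M.mulVec x) := by fun_prop
  exact this.aemeasurable

lemma pl_Phi_sub {a b : ℝ} (h : a ≤ b) :
    gaussianReal 0 1 (Set.Icc a b) = ENNReal.ofReal (stdNormCDF b - stdNormCDF a) := by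
  have := nullSingletonClass_gaussianReal (μ := 0) (v := 1) one_ne_zero
  rw [← measure_congr (Ioc_ae_eq_Icc (a := a) (b := b))]
  conv_lhs => rw [← measure_cdf (gaussianReal 0 1)]
  rw [StieltjesFunction.measure_Ioc]
  rfl

lemma pl_Phi_mono : Monotone stdNormCDF := monotone_cdf _

lemma pl_Phi_strictMono : StrictMono stdNormCDF := by
  intro a b h
  by_contra hc
  have h0 : gaussianReal 0 1 (Set.Icc a b) = 0 := by
    rw [pl_Phi_sub h.le, ENNReal.ofReal_eq_zero]; linarith
  have := gaussianReal_absolutelyContinuous' 0 (v := 1) one_ne_zero h0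
  rw [Real.volume_Icc, ENNReal.ofReal_eq_zero] at this
  linarith

lemma pl_Phi_cont : Continuous stdNormCDF := by
  have := nullSingletonClass_gaussianReal (μ := 0) (v := 1) one_ne_zero
  rw [continuous_iff_continuousAt]
  intro x
  have h := StieltjesFunction.measure_singleton (cdf (gaussianReal 0 1)) x
  rw [measure_cdf, measure_singleton] at h
  have h2 := ENNReal.ofReal_eq_zero.1 h.symm
  have hm : Monotone (cdf (gaussianReal 0 1)) := monotone_cdf _
  show ContinuousAt (cdf (gaussianReal 0 1)) x
  rw [hm.continuousAt_iff_leftLim_eq_rightLim, StieltjesFunction.rightLim_eq]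
  exact le_antisymm (hm.leftLim_le le_rfl) (by linarith)

/-- One-dimensional truncated transform. -/
lemma pl_oneD {a b : ℝ} (h : a < b) :
    ((gaussianReal 0 1).restrict (Set.Icc a b)).map
      (fun t => (stdNormCDF t - stdNormCDF a) / (stdNormCDF b - stdNormCDF a)) =
    (gaussianReal 0 1 (Set.Icc a b)) • (volume.restrict (Set.Icc (0:ℝ) 1)) := by
  have hd : 0 < stdNormCDF b - stdNormCDF a := sub_pos.2 (pl_Phi_strictMono h)
  have hc : Continuous (fun t => (stdNormCDF t - stdNormCDF a) / (stdNormCDF b - stdNormCDF a)) := by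
    have := pl_Phi_cont
    fun_prop
  have : IsFiniteMeasure ((gaussianReal 0 1 (Set.Icc a b)) •
      (volume.restrict (Set.Icc (0:ℝ) 1))) := Measure.smul_finite _ (measure_ne_top _ _)
  refine Measure.ext_of_Iic _ _ (fun x => ?_)
  rw [Measure.map_apply hc.measurable measurableSet_Iic,
    Measure.restrict_apply (hc.measurable measurableSet_Iic), Measure.smul_apply,
    Measure.restrict_apply measurableSet_Iic, smul_eq_mul]
  rcases lt_or_ge x 0 with hx | hx
  · have e1 : (fun t => (stdNormCDF t - stdNormCDF a) / (stdNormCDF b - stdNormCDF a)) ⁻¹' Set.Iic x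
        ∩ Set.Icc a b = ∅ := by
      ext t
      simp only [Set.mem_inter_iff, Set.mem_preimage, Set.mem_Iic, Set.mem_Icc,
        Set.mem_empty_iff_false, iff_false]
      rintro ⟨h1, h2, h3⟩
      have : 0 ≤ (stdNormCDF t - stdNormCDF a) / (stdNormCDF b - stdNormCDF a) :=
        div_nonneg (sub_nonneg.2 (pl_Phi_mono h2)) hd.le
      linarith
    have e2 : Set.Iic x ∩ Set.Icc 0 1 = ∅ := by
      ext t
      simp only [Set.mem_inter_iff, Set.mem_Iic, Set.mem_Icc,
        Set.mem_empty_iff_false, iff_false]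
      rintro ⟨h1, h2, h3⟩
      linarith
    rw [e1, e2]; simp
  rcases le_or_gt x 1 with hx1 | hx1
  · obtain ⟨t0, ht0, hF⟩ : x ∈ (fun t => (stdNormCDF t - stdNormCDF a) /
        (stdNormCDF b - stdNormCDF a)) '' Set.Icc a b := by
      apply intermediate_value_Icc h.le hc.continuousOn
      simp [div_self hd.ne', hx, hx1]
    have hF' : stdNormCDF t0 - stdNormCDF a = x * (stdNormCDF b - stdNormCDF a) := by
      rw [← hF]; field_simp
    have e1 : (fun t => (stdNormCDF t - stdNormCDF a) / (stdNormCDF b - stdNormCDF a)) ⁻¹' Set.Iic x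
        ∩ Set.Icc a b = Set.Icc a t0 := by
      ext t
      simp only [Set.mem_inter_iff, Set.mem_preimage, Set.mem_Iic, Set.mem_Icc]
      rw [← hF, div_le_div_iff_of_pos_right hd, sub_le_sub_iff_right,
        pl_Phi_strictMono.le_iff_le]
      exact ⟨fun hh => ⟨hh.2.1, hh.1⟩, fun hh => ⟨hh.2, hh.1, hh.2.trans ht0.2⟩⟩
    have e2 : Set.Iic x ∩ Set.Icc 0 1 = Set.Icc 0 x := by
      ext t
      simp only [Set.mem_inter_iff, Set.mem_Iic, Set.mem_Icc]
      exact ⟨fun hh => ⟨hh.2.1, hh.1⟩, fun hh => ⟨hh.2, hh.1, hh.2.trans hx1⟩⟩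
    rw [e1, e2, pl_Phi_sub ht0.1, hF', pl_Phi_sub h.le, Real.volume_Icc, sub_zero,
      ← ENNReal.ofReal_mul hd.le, mul_comm]
  · have e1 : (fun t => (stdNormCDF t - stdNormCDF a) / (stdNormCDF b - stdNormCDF a)) ⁻¹' Set.Iic x
        ∩ Set.Icc a b = Set.Icc a b := by
      refine Set.inter_eq_right.2 (fun t ht => ?_)
      simp only [Set.mem_preimage, Set.mem_Iic]
      refine le_trans ?_ hx1.le
      rw [div_le_one hd]
      have := pl_Phi_mono ht.2
      linarith
    have e2 : Set.Iic x ∩ Set.Icc 0 1 = Set.Icc (0:ℝ) 1 :=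
      Set.inter_eq_right.2 (fun t ht => ht.2.trans hx1.le)
    rw [e1, e2]; simp

lemma pl_oneD' (a b : ℝ) {s : Set ℝ} (hs : MeasurableSet s) :
    gaussianReal 0 1 {t | (a ≤ t ∧ t ≤ b) ∧
      (stdNormCDF t - stdNormCDF a) / (stdNormCDF b - stdNormCDF a) ∈ s} =
    gaussianReal 0 1 (Set.Icc a b) * volume (s ∩ Set.Icc (0:ℝ) 1) := by
  rcases lt_or_ge a b with h | h
  · have h1 := congrArg (fun m => m s) (pl_oneD h)
    have hc : Measurable
        (fun t => (stdNormCDF t - stdNormCDF a) / (stdNormCDF b - stdNormCDF a)) := by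
      have := pl_Phi_cont.measurable
      fun_prop
    rw [Measure.map_apply hc hs, Measure.restrict_apply (hc hs), Measure.smul_apply,
      Measure.restrict_apply hs, smul_eq_mul] at h1
    rw [← h1]
    congr 1
    ext t
    simp [and_comm]
  · have h0 : gaussianReal 0 1 (Set.Icc a b) = 0 := by
      have := nullSingletonClass_gaussianReal (μ := 0) (v := 1) one_ne_zero
      rcases h.eq_or_lt with h | h
      · subst h; simp
      · rw [Set.Icc_eq_empty (not_le.2 h)]; simp
    rw [h0, zero_mul]
    exact measure_mono_null (fun t ht => ht.1) h0

lemma pl_prod {X : Type*} [MeasurableSpace X] (κ : Measure X) [SFinite κ]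
    (D : Set X) (hD : MeasurableSet D) (a b : X → ℝ) (ha : Measurable a) (hb : Measurable b)
    {s : Set ℝ} (hs : MeasurableSet s) :
    ((gaussianReal 0 1).prod κ) {p | (p.2 ∈ D ∧ a p.2 ≤ p.1 ∧ p.1 ≤ b p.2) ∧
      (stdNormCDF p.1 - stdNormCDF (a p.2)) / (stdNormCDF (b p.2) - stdNormCDF (a p.2)) ∈ s} =
    ((gaussianReal 0 1).prod κ) {p | p.2 ∈ D ∧ a p.2 ≤ p.1 ∧ p.1 ≤ b p.2} *
      volume (s ∩ Set.Icc (0:ℝ) 1) := by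
  have hΦ := pl_Phi_cont.measurable
  have m1 : MeasurableSet {p : ℝ × X | p.2 ∈ D ∧ a p.2 ≤ p.1 ∧ p.1 ≤ b p.2} :=
    (measurable_snd hD).inter ((measurableSet_le (ha.comp measurable_snd) measurable_fst).inter
      (measurableSet_le measurable_fst (hb.comp measurable_snd)))
  have m2 : Measurable (fun p : ℝ × X => (stdNormCDF p.1 - stdNormCDF (a p.2)) /
      (stdNormCDF (b p.2) - stdNormCDF (a p.2))) := by fun_prop
  have m3 : MeasurableSet {p : ℝ × X | (p.2 ∈ D ∧ a p.2 ≤ p.1 ∧ p.1 ≤ b p.2) ∧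
      (stdNormCDF p.1 - stdNormCDF (a p.2)) / (stdNormCDF (b p.2) - stdNormCDF (a p.2)) ∈ s} :=
    m1.inter (m2 hs)
  rw [Measure.prod_apply_symm m1, Measure.prod_apply_symm m3,
    ← lintegral_mul_const _ (measurable_measure_prodMk_right m1)]
  refine lintegral_congr (fun w => ?_)
  by_cases hw : w ∈ D
  · simp only [Set.preimage_setOf_eq, hw, true_and]
    exact pl_oneD' _ _ hs
  · simp [hw]

lemma pl_finite {n : ℕ} (B : Matrix (Fin n) (Fin n) ℝ) (η c : Fin n → ℝ) (v : ℝ) (hv : 0 < v)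
    (hBB : (B * Bᵀ).mulVec η = v • c) (hvv : η ⬝ᵥ (B * Bᵀ).mulVec η = v) :
    (B - vecMulVec c (Bᵀ.mulVec η)).mulVec ((Real.sqrt v)⁻¹ • Bᵀ.mulVec η) = 0 ∧
    ((Real.sqrt v)⁻¹ • Bᵀ.mulVec η) ⬝ᵥ ((Real.sqrt v)⁻¹ • Bᵀ.mulVec η) = 1 := by
  have huu : Bᵀ.mulVec η ⬝ᵥ Bᵀ.mulVec η = v := by
    rw [← hvv, ← mulVec_mulVec, dotProduct_mulVec η B, ← mulVec_transpose]
  constructor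
  · rw [mulVec_smul, sub_mulVec, mulVec_mulVec, hBB, vecMulVec_mulVec, huu]
    simp
  · rw [smul_dotProduct, dotProduct_smul, huu]
    have h1 : Real.sqrt v * Real.sqrt v = v := Real.mul_self_sqrt hv.le
    have h2 : Real.sqrt v ≠ 0 := (Real.sqrt_pos.2 hv).ne'
    simp only [smul_eq_mul]
    field_simp
    nlinarith

/-- Lee et al.'s polyhedral lemma: conditional on the polyhedral selection event
`{y : A y ≤ b}`, the truncated-normal CDF transform of `ηᵀ y` (with truncation limits
`V⁻(y)`, `V⁺(y)`) is uniformly distributed on `[0,1]`. -/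
theorem stmt_0 (n m : ℕ)
    (P : Measure (Fin n → ℝ)) (μ : Fin n → ℝ) (S : Matrix (Fin n) (Fin n) ℝ)
    (hS : S.PosDef) (hP : IsGaussianMeasure n P μ S)
    (A : Matrix (Fin m) (Fin n) ℝ) (b : Fin m → ℝ) (η : Fin n → ℝ)
    (hη : 0 < η ⬝ᵥ S.mulVec η)
    (c : Fin n → ℝ) (hc : c = (η ⬝ᵥ S.mulVec η)⁻¹ • S.mulVec η)
    (z : (Fin n → ℝ) → (Fin n → ℝ)) (hz : ∀ y, z y = y - (η ⬝ᵥ y) • c)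
    (hJneg : (Finset.univ.filter (fun j => A.mulVec c j < 0)).Nonempty)
    (hJpos : (Finset.univ.filter (fun j => 0 < A.mulVec c j)).Nonempty)
    (Vmin Vmax : (Fin n → ℝ) → ℝ)
    (hVmin : ∀ y, Vmin y = (Finset.univ.filter (fun j => A.mulVec c j < 0)).sup' hJneg
      (fun j => (b j - A.mulVec (z y) j) / A.mulVec c j))
    (hVmax : ∀ y, Vmax y = (Finset.univ.filter (fun j => 0 < A.mulVec c j)).inf' hJpos
      (fun j => (b j - A.mulVec (z y) j) / A.mulVec c j))
    (E : Set (Fin n → ℝ)) (hE : E = {y | ∀ j, A.mulVec y j ≤ b j})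
    (hPE : 0 < P E) :
    Measure.map
      (fun y => truncNormCDF (η ⬝ᵥ y) (Vmin y) (Vmax y) (η ⬝ᵥ μ) (η ⬝ᵥ S.mulVec η))
      (P[|E]) = volume.restrict (Set.Icc (0 : ℝ) 1) := by
  obtain ⟨B, hB, rfl⟩ := hP
  set v := η ⬝ᵥ S.mulVec η with hv
  have hSη : S.mulVec η = v • c := by rw [hc, smul_smul, mul_inv_cancel₀ hη.ne', one_smul]
  obtain ⟨hMu, huu⟩ := pl_finite B η c v hη (by rw [hB, hSη]) (by rw [hB])
  set M := B - vecMulVec c (Bᵀ.mulVec η) with hM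
  set u := (Real.sqrt v)⁻¹ • Bᵀ.mulVec η with hu
  have hσ : 0 < Real.sqrt v := Real.sqrt_pos.2 hη
  have hprod := pl_map_prod n u M hMu huu
  set κ := (stdGaussianPi n).map (fun x => M.mulVec x) with hκ
  -- the affine map
  set f : (Fin n → ℝ) → (Fin n → ℝ) := fun x => μ + B.mulVec x with hf
  have hfm : Measurable f := by
    have : Continuous f := by fun_prop
    exact this.measurable
  have hηf : ∀ x, η ⬝ᵥ f x = η ⬝ᵥ μ + Real.sqrt v * (u ⬝ᵥ x) := by
    intro x
    rw [hf, hu, dotProduct_add, smul_dotProduct, smul_eq_mul, mul_inv_cancel_left₀ hσ.ne',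
      dotProduct_mulVec, mulVec_transpose]
  have hzf : ∀ x, z (f x) = z μ + M.mulVec x := by
    intro x
    have h1 : η ⬝ᵥ f x = η ⬝ᵥ μ + Bᵀ.mulVec η ⬝ᵥ x := by
      rw [hf, dotProduct_add, dotProduct_mulVec, mulVec_transpose]
    rw [hz, hz, h1, hM, sub_mulVec, vecMulVec_mulVec]
    ext i
    simp [hf]
    ring
  set lo : (Fin n → ℝ) → ℝ := fun w =>
    ((Finset.univ.filter (fun j => A.mulVec c j < 0)).sup' hJneg
      (fun j => (b j - A.mulVec (z μ + w) j) / A.mulVec c j) - η ⬝ᵥ μ) / Real.sqrt v with hlo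
  set hi : (Fin n → ℝ) → ℝ := fun w =>
    ((Finset.univ.filter (fun j => 0 < A.mulVec c j)).inf' hJpos
      (fun j => (b j - A.mulVec (z μ + w) j) / A.mulVec c j) - η ⬝ᵥ μ) / Real.sqrt v with hhi
  have hcoord : ∀ j, Continuous (fun w => (b j - A.mulVec (z μ + w) j) / A.mulVec c j) := by
    intro j
    have h1 : Continuous (fun w => A.mulVec (z μ + w)) := by fun_prop
    have h2 : Continuous (fun w => A.mulVec (z μ + w) j) := (continuous_apply j).comp h1
    fun_prop
  have hlom : Measurable lo := by
    refine Continuous.measurable ?_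
    have := Continuous.finset_sup'_apply hJneg (fun j _ => hcoord j)
    fun_prop
  have hhim : Measurable hi := by
    refine Continuous.measurable ?_
    have := Continuous.finset_inf'_apply hJpos (fun j _ => hcoord j)
    fun_prop
  have hloV : ∀ x, (Vmin (f x) - η ⬝ᵥ μ) / Real.sqrt v = lo (M.mulVec x) := by
    intro x; rw [hVmin, hzf]
  have hhiV : ∀ x, (Vmax (f x) - η ⬝ᵥ μ) / Real.sqrt v = hi (M.mulVec x) := by
    intro x; rw [hVmax, hzf]
  have hT : ∀ x, (η ⬝ᵥ f x - η ⬝ᵥ μ) / Real.sqrt v = u ⬝ᵥ x := by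
    intro x; rw [hηf]; field_simp; ring
  set D : Set (Fin n → ℝ) := {w | ∀ j, A.mulVec c j = 0 → A.mulVec (z μ + w) j ≤ b j} with hD
  have hDm : MeasurableSet D := by
    have : D = ⋂ j, {w | A.mulVec c j = 0 → A.mulVec (z μ + w) j ≤ b j} := by
      ext w; simp [hD]
    rw [this]
    refine MeasurableSet.iInter (fun j => ?_)
    by_cases h0 : A.mulVec c j = 0
    · simp only [h0, true_imp_iff]
      have h1 : Continuous (fun w => A.mulVec (z μ + w)) := by fun_prop
      have h2 : Continuous (fun w => A.mulVec (z μ + w) j) := (continuous_apply j).comp h1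
      exact measurableSet_le h2.measurable measurable_const
    · simp [h0]
  have hEiff : ∀ x, f x ∈ E ↔ (M.mulVec x ∈ D ∧ lo (M.mulVec x) ≤ u ⬝ᵥ x ∧
      u ⬝ᵥ x ≤ hi (M.mulVec x)) := by
    intro x
    have hfx : f x = z (f x) + (η ⬝ᵥ f x) • c := by rw [hz]; simp
    have hA : ∀ j, A.mulVec (f x) j =
        A.mulVec (z μ + M.mulVec x) j + (η ⬝ᵥ f x) * A.mulVec c j := by
      intro j
      conv_lhs => rw [hfx, hzf, mulVec_add, mulVec_smul]
      simp
    rw [← hloV, ← hhiV, ← hT, div_le_div_iff_of_pos_right hσ, div_le_div_iff_of_pos_right hσ,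
      sub_le_sub_iff_right, sub_le_sub_iff_right, hVmin, hVmax, Finset.sup'_le_iff,
      Finset.le_inf'_iff, hzf, hE]
    simp only [Set.mem_ofPred_eq, hD, Finset.mem_filter, Finset.mem_univ, true_and, hA]
    constructor
    · intro h
      refine ⟨fun j hj => ?_, fun j hj => ?_, fun j hj => ?_⟩
      · have := h j; rw [hj] at this; linarith
      · rw [div_le_iff_of_neg hj]; linarith [h j]
      · rw [le_div_iff₀ hj]; linarith [h j]
    · rintro ⟨h0, h1, h2⟩ j
      rcases lt_trichotomy (A.mulVec c j) 0 with hj | hj | hj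
      · have := h1 j hj; rw [div_le_iff_of_neg hj] at this; linarith
      · have := h0 j hj; rw [hj]; linarith
      · have := h2 j hj; rw [le_div_iff₀ hj] at this; linarith
  have hEm : MeasurableSet E := by
    have : E = ⋂ j, {y | A.mulVec y j ≤ b j} := by ext y; simp [hE]
    rw [this]
    refine MeasurableSet.iInter (fun j => ?_)
    have h1 : Continuous (fun w => A.mulVec w) := by fun_prop
    have h2 : Continuous (fun w => A.mulVec w j) := (continuous_apply j).comp h1
    exact measurableSet_le h2.measurable measurable_const
  have hzc : Continuous z := by
    have : z = fun y => y - (η ⬝ᵥ y) • c := funext hz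
    rw [this]
    fun_prop
  have hcoord' : ∀ j, Continuous (fun y => (b j - A.mulVec (z y) j) / A.mulVec c j) := by
    intro j
    have h1 : Continuous (fun y => A.mulVec (z y)) := by fun_prop
    have h2 : Continuous (fun y => A.mulVec (z y) j) := (continuous_apply j).comp h1
    fun_prop
  have hVminm : Measurable Vmin := by
    rw [funext hVmin]
    exact (Continuous.finset_sup'_apply hJneg (fun j _ => hcoord' j)).measurable
  have hVmaxm : Measurable Vmax := by
    rw [funext hVmax]
    exact (Continuous.finset_inf'_apply hJpos (fun j _ => hcoord' j)).measurable
  have hG : Measurable (fun y => truncNormCDF (η ⬝ᵥ y) (Vmin y) (Vmax y) (η ⬝ᵥ μ) v) := by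
    have hΦ := pl_Phi_cont.measurable
    have hd : Measurable (fun y : Fin n → ℝ => η ⬝ᵥ y) := by
      have : Continuous (fun y : Fin n → ℝ => η ⬝ᵥ y) := by fun_prop
      exact this.measurable
    unfold truncNormCDF
    fun_prop
  have hpm : Measurable (fun x : Fin n → ℝ => (u ⬝ᵥ x, M.mulVec x)) := by
    have : Continuous (fun x : Fin n → ℝ => (u ⬝ᵥ x, M.mulVec x)) := by fun_prop
    exact this.measurable
  have hΦ := pl_Phi_cont.measurable
  have m1 : MeasurableSet {p : ℝ × (Fin n → ℝ) | p.2 ∈ D ∧ lo p.2 ≤ p.1 ∧ p.1 ≤ hi p.2} :=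
    (measurable_snd hDm).inter ((measurableSet_le (hlom.comp measurable_snd) measurable_fst).inter
      (measurableSet_le measurable_fst (hhim.comp measurable_snd)))
  have m2 : Measurable (fun p : ℝ × (Fin n → ℝ) => (stdNormCDF p.1 - stdNormCDF (lo p.2)) /
      (stdNormCDF (hi p.2) - stdNormCDF (lo p.2))) := by fun_prop
  have hPE' : ((stdGaussianPi n).map f) E = ((gaussianReal 0 1).prod κ)
      {p | p.2 ∈ D ∧ lo p.2 ≤ p.1 ∧ p.1 ≤ hi p.2} := by
    rw [← hprod, Measure.map_apply hpm m1, Measure.map_apply hfm hEm]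
    congr 1
    ext x
    exact hEiff x
  have hPtop : ((stdGaussianPi n).map f) E ≠ ⊤ := by
    have := Measure.isProbabilityMeasure_map (μ := stdGaussianPi n) hfm.aemeasurable
    exact measure_ne_top _ _
  refine Measure.ext (fun s hs => ?_)
  rw [Measure.map_apply hG hs, cond_apply hEm, Measure.restrict_apply hs]
  have m3 : MeasurableSet {p : ℝ × (Fin n → ℝ) | (p.2 ∈ D ∧ lo p.2 ≤ p.1 ∧ p.1 ≤ hi p.2) ∧
      (stdNormCDF p.1 - stdNormCDF (lo p.2)) / (stdNormCDF (hi p.2) - stdNormCDF (lo p.2)) ∈ s} :=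
    m1.inter (m2 hs)
  have key : ((stdGaussianPi n).map f) (E ∩ (fun y => truncNormCDF (η ⬝ᵥ y) (Vmin y) (Vmax y)
      (η ⬝ᵥ μ) v) ⁻¹' s) = ((stdGaussianPi n).map f) E * volume (s ∩ Set.Icc (0:ℝ) 1) := by
    rw [hPE', ← pl_prod κ D hDm lo hi hlom hhim hs, ← hprod,
      Measure.map_apply hpm m3, Measure.map_apply hfm (hEm.inter (hG hs))]
    congr 1
    ext x
    refine and_congr (hEiff x) ?_
    simp only [Set.mem_preimage, truncNormCDF, hT, hloV, hhiV]
  rw [key, ← mul_assoc, ENNReal.inv_mul_cancel hPE.ne' hPtop, one_mul]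
end

section
/- Let $n \ge 1$ and let $\gamma$ be the standard Gaussian measure on $\mathbb{R}^n$ (the $n$-fold product of standard normal distributions). Then the pushforward of $\gamma$ under the map $z \mapsto \sum_{i=1}^n \big(\max(z_i, 0)\big)^2$ equals the mixture $\sum_{i=0}^{n} \binom{n}{i} 2^{-n}\, \chi^2_i$, where $\chi^2_0$ is the Dirac measure at $0$ and, for $i \ge 1$, $\chi^2_i$ is the chi-squared distribution with $i$ degrees of freedom, i.e., the Gamma distribution with shape $i/2$ and rate $1/2$. -/
open MeasureTheory ProbabilityTheory ENNReal

/-- The chi-squared distribution with `i` degrees of freedom: the Dirac mass at `0`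
for `i = 0`, and the Gamma distribution with shape `i/2` and rate `1/2` for `i ≥ 1`. -/
noncomputable def chiSqMeasure (i : ℕ) : Measure ℝ :=
  if i = 0 then Measure.dirac 0 else gammaMeasure ((i : ℝ) / 2) (1 / 2)

lemma gamma_mgf {a r t : ℝ} (ha : 0 < a) (hr : 0 < r) (ht : t < r) :
    mgf id (gammaMeasure a r) t = (r / (r - t)) ^ a := by
  have hs : 0 < r - t := by linarith
  have h1 : ∫ x, gammaPDFReal a (r - t) x = 1 := by
    rw [integral_eq_lintegral_of_nonneg_ae]
    · have := lintegral_gammaPDF_eq_one ha hs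
      simp only [gammaPDF] at this
      rw [this]; simp
    · exact Filter.Eventually.of_forall (gammaPDFReal_nonneg ha hs)
    · exact (measurable_gammaPDFReal _ _).aestronglyMeasurable
  rw [mgf, gammaMeasure, integral_withDensity_eq_integral_toReal_smul]
  · rw [← mul_one ((r / (r - t)) ^ a), ← h1, ← integral_const_mul]
    congr 1
    ext x
    rw [gammaPDF, ENNReal.toReal_ofReal (gammaPDFReal_nonneg ha hr x), gammaPDFReal, gammaPDFReal]
    split_ifs
    · rw [Real.div_rpow hr.le hs.le, id, smul_eq_mul, mul_assoc _ (Real.exp _), ← Real.exp_add]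
      have : (r - t) ^ a ≠ 0 := (Real.rpow_pos_of_pos hs a).ne'
      have h2 : -(r * x) + t * x = -((r - t) * x) := by ring
      rw [h2]
      field_simp
    · simp
  · exact (measurable_gammaPDFReal _ _).ennreal_ofReal
  · simp [gammaPDF]

lemma gamma_charFun {a r : ℝ} (ha : 0 < a) (hr : 0 < r) (t : ℝ) :
    charFun (gammaMeasure a r) t = ((r : ℂ) / (r - t * Complex.I)) ^ (a : ℂ) := by
  have hsub : Set.Iio r ⊆ interior (integrableExpSet id (gammaMeasure a r)) := by
    refine interior_maximal ?_ isOpen_Iio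
    intro s (hs : s < r)
    refine Integrable.of_integral_ne_zero ?_
    have := gamma_mgf ha hr hs
    rw [mgf] at this
    rw [this]
    have : 0 < r - s := by linarith
    positivity
  have hopen : IsOpen {z : ℂ | z.re < r} := isOpen_lt Complex.continuous_re continuous_const
  have hf : AnalyticOnNhd ℂ (complexMGF id (gammaMeasure a r)) {z | z.re < r} :=
    analyticOnNhd_complexMGF.mono (fun z hz => hsub hz)
  have hg : AnalyticOnNhd ℂ (fun z : ℂ => ((r : ℂ) / (r - z)) ^ (a : ℂ)) {z | z.re < r} := by
    refine DifferentiableOn.analyticOnNhd ?_ hopen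
    intro z (hz : z.re < r)
    have hre : 0 < ((r : ℂ) - z).re := by simpa using hz
    have hne : (r : ℂ) - z ≠ 0 := fun h => by rw [h] at hre; simp at hre
    refine DifferentiableAt.differentiableWithinAt ?_
    refine DifferentiableAt.cpow (by fun_prop (disch := exact hne)) (by fun_prop) ?_
    left
    rw [div_eq_mul_inv, Complex.re_ofReal_mul, Complex.inv_re]
    have := Complex.normSq_pos.2 hne
    positivity
  have hconv : IsPreconnected {z : ℂ | z.re < r} := (convex_halfSpace_re_lt r).isPreconnected
  have key := hf.eqOn_of_preconnected_of_frequently_eq hg hconv (z₀ := 0) (by simpa using hr) ?_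
  · rw [← complexMGF_id_mul_I]
    exact key (by simpa using hr)
  · have hreal : ∃ᶠ (x : ℝ) in nhdsWithin 0 {0}ᶜ, complexMGF id (gammaMeasure a r) x
        = ((r : ℂ) / (r - x)) ^ (a : ℂ) := by
      refine Filter.Eventually.frequently ?_
      filter_upwards [mem_nhdsWithin_of_mem_nhds (Iio_mem_nhds hr)] with x (hx : x < r)
      have : 0 < r - x := by linarith
      rw [complexMGF_ofReal, gamma_mgf ha hr hx, Complex.ofReal_cpow (by positivity)]
      push_cast
      rfl
    have htend : Filter.Tendsto (fun x : ℝ => (x : ℂ)) (nhdsWithin 0 {0}ᶜ) (nhdsWithin 0 {0}ᶜ) := by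
      refine tendsto_nhdsWithin_iff.2 ⟨?_, ?_⟩
      · exact (Complex.continuous_ofReal.tendsto' 0 0 (by simp)).mono_left nhdsWithin_le_nhds
      · filter_upwards [self_mem_nhdsWithin] with x hx
        simpa using hx
    exact htend.frequently hreal

lemma chi_charFun (k : ℕ) (t : ℝ) :
    charFun (chiSqMeasure k) t = (((1 / 2 : ℂ) / (1 / 2 - t * Complex.I)) ^ (1 / 2 : ℂ)) ^ k := by
  rw [chiSqMeasure]
  split_ifs with h
  · simp [h]
  · rw [gamma_charFun (by positivity) (by norm_num), ← Complex.cpow_nat_mul]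
    push_cast
    congr 1
    ring

instance (k : ℕ) : IsProbabilityMeasure (chiSqMeasure k) := by
  rw [chiSqMeasure]
  split_ifs with h
  · infer_instance
  · exact isProbabilityMeasure_gammaMeasure (by positivity) (by norm_num)

lemma one_charFun (t : ℝ) :
    charFun ((gaussianReal 0 1).map (fun x => (max x 0) ^ 2)) t =
      1 / 2 + 1 / 2 * ((1 / 2 : ℂ) / (1 / 2 - t * Complex.I)) ^ (1 / 2 : ℂ) := by
  set b : ℂ := 1 / 2 - t * Complex.I with hb
  have hbre : 0 < b.re := by simp [hb]
  rw [charFun_apply_real, integral_map (by fun_prop) (by fun_prop)]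
  have hint : Integrable (fun x : ℝ => Complex.exp (t * ((max x 0 ^ 2 : ℝ) : ℂ) * Complex.I))
      (gaussianReal 0 1) := by
    refine Integrable.of_bound (C := 1) (by fun_prop) (Filter.Eventually.of_forall fun x => ?_)
    rw [← Complex.ofReal_mul, Complex.norm_exp_ofReal_mul_I]
  have hconst : ((√(2 * Real.pi))⁻¹ : ℝ) * ((Real.pi / b) ^ (1 / 2 : ℂ) / 2)
      = 1 / 2 * ((1 / 2 : ℂ) / b) ^ (1 / 2 : ℂ) := by
    have e1 : (Real.pi : ℂ) / b = ((2 * Real.pi : ℝ) : ℂ) * ((1 / 2 : ℂ) / b) := by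
      push_cast; ring
    have e2 : (((2 * Real.pi : ℝ) : ℂ) * ((1 / 2 : ℂ) / b)) ^ (1 / 2 : ℂ)
        = ((2 * Real.pi : ℝ) : ℂ) ^ (1 / 2 : ℂ) * ((1 / 2 : ℂ) / b) ^ (1 / 2 : ℂ) := by
      have hbne : b ≠ 0 := fun h => by rw [h] at hbre; simp at hbre
      have hz : (1 / 2 : ℂ) / b ≠ 0 := div_ne_zero (by norm_num) hbne
      have hp : (0 : ℝ) < 2 * Real.pi := by positivity
      have hpc : ((2 * Real.pi : ℝ) : ℂ) ≠ 0 := Complex.ofReal_ne_zero.2 hp.ne'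
      rw [Complex.cpow_def_of_ne_zero (mul_ne_zero hpc hz), Complex.cpow_def_of_ne_zero hpc,
        Complex.cpow_def_of_ne_zero hz, Complex.log_ofReal_mul hp hz, ← Complex.exp_add,
        Complex.ofReal_log hp.le, add_mul]
    have e3 : ((2 * Real.pi : ℝ) : ℂ) ^ (1 / 2 : ℂ) = (√(2 * Real.pi) : ℝ) := by
      rw [Real.sqrt_eq_rpow, Complex.ofReal_cpow (by positivity)]
      simp
    have e4 : ((√(2 * Real.pi) : ℝ) : ℂ) ≠ 0 := by
      rw [Complex.ofReal_ne_zero]; positivity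
    rw [e1, e2, e3, Complex.ofReal_inv]
    field_simp
  have hhalf : ∫ x in Set.Ioi (0 : ℝ), Real.exp (-(1 / 2) * x ^ 2) = √(2 * Real.pi) / 2 := by
    rw [integral_gaussian_Ioi]
    congr 2
    ring
  rw [integral_gaussianReal_eq_integral_smul one_ne_zero,
    ← integral_add_compl (s := Set.Iic 0) measurableSet_Iic, Set.compl_Iic]
  · congr 1
    · trans ∫ x in Set.Iic (0 : ℝ),
        (((√(2 * Real.pi))⁻¹ * Real.exp (-(1 / 2) * (-x) ^ 2) : ℝ) : ℂ)
      · refine setIntegral_congr_fun measurableSet_Iic fun x (hx : x ≤ 0) => ?_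
        simp only [gaussianPDFReal, max_eq_right hx]
        simp
        left
        congr 1
        ring
      · rw [integral_complex_ofReal, integral_comp_neg_Iic 0
          (fun x => (√(2 * Real.pi))⁻¹ * Real.exp (-(1 / 2) * x ^ 2)), neg_zero,
          integral_const_mul, hhalf]
        have : √(2 * Real.pi) ≠ 0 := by positivity
        rw [show (√(2 * Real.pi))⁻¹ * (√(2 * Real.pi) / 2) = 1 / 2 by field_simp]
        simp
    · rw [← hconst, ← integral_gaussian_complex_Ioi hbre, ← integral_const_mul]
      refine setIntegral_congr_fun measurableSet_Ioi fun x (hx : 0 < x) => ?_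
      simp only [gaussianPDFReal, max_eq_left hx.le]
      rw [Complex.real_smul, Complex.ofReal_mul, mul_assoc, Complex.ofReal_exp, ← Complex.exp_add]
      congr 2
      · simp
      · rw [hb]; push_cast; ring
  · rw [gaussianReal_of_var_ne_zero _ one_ne_zero,
      integrable_withDensity_iff_integrable_smul' (measurable_gaussianPDF _ _)
        (Filter.Eventually.of_forall fun x => gaussianPDF_lt_top)] at hint
    simpa [toReal_gaussianPDF] using hint

/-- The chi-bar-square law: the sum of squared positive parts of `n` i.i.d. standard
normals is distributed as the mixture `∑ᵢ C(n,i) 2⁻ⁿ χ²ᵢ`. -/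
theorem stmt_12 (n : ℕ) (hn : 1 ≤ n) :
    Measure.map (fun z : Fin n → ℝ => ∑ i, (max (z i) 0) ^ 2) (stdGaussianPi n) =
      ∑ i ∈ Finset.range (n + 1), ((n.choose i : ℝ≥0∞) / 2 ^ n) • chiSqMeasure i := by
  have hm : Measurable (fun x : ℝ => (max x 0) ^ 2) := by fun_prop
  have : IsProbabilityMeasure ((gaussianReal 0 1).map (fun x => (max x 0) ^ 2)) :=
    Measure.isProbabilityMeasure_map hm.aemeasurable
  have hmap : Measure.map (fun z : Fin n → ℝ => ∑ i, (max (z i) 0) ^ 2) (stdGaussianPi n) =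
      (Measure.pi fun _ : Fin n => (gaussianReal 0 1).map (fun x => (max x 0) ^ 2)).map
        (fun p => ∑ i, p i) := by
    rw [stdGaussianPi, ← Measure.pi_map_pi (fun _ => hm.aemeasurable),
      Measure.map_map (by fun_prop) (by fun_prop)]
    rfl
  have hfin : ∀ i, (n.choose i : ℝ≥0∞) / 2 ^ n ≠ ∞ := fun i =>
    ENNReal.div_ne_top (by simp) (by simp)
  have hF : ∀ i, IsFiniteMeasure (((n.choose i : ℝ≥0∞) / 2 ^ n) • chiSqMeasure i) := fun i =>
    Measure.smul_finite _ (hfin i)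
  have : IsFiniteMeasure
    (∑ i ∈ Finset.range (n + 1), ((n.choose i : ℝ≥0∞) / 2 ^ n) • chiSqMeasure i) := by
    infer_instance
  rw [hmap]
  have : IsFiniteMeasure ((Measure.pi fun _ : Fin n =>
    (gaussianReal 0 1).map (fun x => (max x 0) ^ 2)).map (fun p => ∑ i, p i)) := by
    infer_instance
  refine Measure.ext_of_charFun ?_
  rw [charFun_map_sum_pi_eq_prod]
  ext t
  have hR : charFun (∑ i ∈ Finset.range (n + 1),
      ((n.choose i : ℝ≥0∞) / 2 ^ n) • chiSqMeasure i) t =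
      ∑ i ∈ Finset.range (n + 1), ((n.choose i : ℂ) / 2 ^ n) * charFun (chiSqMeasure i) t := by
    simp only [charFun_apply_real]
    rw [integral_finsetSum_measure]
    · refine Finset.sum_congr rfl fun i _ => ?_
      rw [integral_smul_measure]
      simp
    · intro i _
      refine Integrable.of_bound (C := 1) (by fun_prop) (Filter.Eventually.of_forall fun x => ?_)
      rw [← Complex.ofReal_mul, Complex.norm_exp_ofReal_mul_I]
  rw [hR]
  simp only [chi_charFun, Finset.prod_apply, one_charFun, Finset.prod_const, Finset.card_univ,
    Fintype.card_fin]
  rw [add_comm, add_pow]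
  refine Finset.sum_congr rfl fun i hi => ?_
  have : i ≤ n := by simpa [Nat.lt_succ_iff] using hi
  rw [mul_pow, mul_right_comm, ← pow_sub_mul_pow (2 : ℂ) this]
  simp only [one_div, inv_pow]
  field_simp
end
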